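/- Let n ≥ 1, let h be a gauge function, and let R be a roof function supported in the unit cube [0,1]^n. Then M_h(R) ≤ 3^n · sup_{f ∈ F_n(R,h)} ‖f‖_1. Combined with the trivial inequality sup_{f ∈ F_n(R,h)} ‖f‖_1 ≤ M_h(R), this gives sup_{f ∈ F_n(R,h)} ‖f‖_1 ≍_n M_h(R) with proportionality constant 3^n. -/

import Mathlib

open MeasureTheory Set Filter Topology

/-- A gauge function: continuous, increasing on `[0,∞)`, vanishing at `0`, with
`(R1)` `h x / x` decreasing and `(R2)` `h x / x → ∞` as `x → 0+`. -/
structure IsGauge (h : ℝ → ℝ) : Prop where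
  continuousOn : ContinuousOn h (Set.Ici 0)
  mono : MonotoneOn h (Set.Ici 0)
  zero : h 0 = 0
  r1 : ∀ ⦃x y : ℝ⦄, 0 < x → x ≤ y → h y / y ≤ h x / x
  r2 : Filter.Tendsto (fun x => h x / x) (nhdsWithin 0 (Set.Ioi 0)) Filter.atTop

/-- A cube in `ℝ^n`: a product of closed intervals of a common positive length. -/
def IsCube {n : ℕ} (c : Set (Fin n → ℝ)) : Prop :=
  ∃ (a : Fin n → ℝ) (s : ℝ), 0 < s ∧ c = Set.univ.pi fun i => Set.Icc (a i) (a i + s)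

/-- The closed unit cube `[0,1]^n`. -/
def unitCube (n : ℕ) : Set (Fin n → ℝ) := Set.univ.pi fun _ => Set.Icc (0 : ℝ) 1

/-- `M_h(R)`: the infimum over all countable families of cubes `{c k}` (degenerate
empty members allowed, so that finite families are included) of
`Σ_k h(V_n(c_k)) + ∫_{ℝ^n \ ∪_k c_k} R dV_n`. -/
noncomputable def Mh {n : ℕ} (h : ℝ → ℝ) (R : (Fin n → ℝ) → ENNReal) : ENNReal :=
  ⨅ (c : ℕ → Set (Fin n → ℝ)) (_ : ∀ k, IsCube (c k) ∨ c k = ∅),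
    (∑' k, ENNReal.ofReal (h (volume (c k)).toReal)) + ∫⁻ x in (⋃ k, c k)ᶜ, R x

/-- Membership in the class `F_n(R,h)`: `f : ℝ^n → [0,∞)` measurable with
`∫_c f ≤ h(V_n(c))` for every cube `c` and `f ≤ R` a.e. -/
structure MemF {n : ℕ} (h : ℝ → ℝ) (R : (Fin n → ℝ) → ENNReal)
    (f : (Fin n → ℝ) → NNReal) : Prop where
  measurable : Measurable f
  cube_bound : ∀ c : Set (Fin n → ℝ), IsCube c →
    ∫⁻ x in c, (f x : ENNReal) ≤ ENNReal.ofReal (h (volume c).toReal)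
  le_roof : ∀ᵐ x ∂volume, (f x : ENNReal) ≤ R x

section DyadicCubes

variable {n : ℕ}

/-- The index of the half-open dyadic cube of side `2⁻ᵏ` containing `x`. -/
noncomputable def dyadicIndex (k : ℕ) (x : Fin n → ℝ) : Fin n → ℤ := fun i => ⌊(2 : ℝ) ^ k * x i⌋

/-- The half-open dyadic cube of side `2⁻ᵏ` with index `z`. -/
def dyadicCube (k : ℕ) (z : Fin n → ℤ) : Set (Fin n → ℝ) := {x | dyadicIndex k x = z}

/-- The index of the dyadic parent. -/
def dyadicParent (z : Fin n → ℤ) : Fin n → ℤ := fun i => z i / 2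

/-- The gauge of a dyadic cube of side `2⁻ᵏ` in dimension `n`. -/
noncomputable def dyadicGauge (n : ℕ) (h : ℝ → ℝ) (k : ℕ) : ENNReal :=
  ENNReal.ofReal (h (((1 / 2 : ℝ) ^ k) ^ n))

theorem measurable_dyadicIndex (k : ℕ) : Measurable (dyadicIndex (n := n) k) := by
  refine measurable_pi_lambda _ fun i => ?_
  exact Int.measurable_floor.comp ((measurable_pi_apply i).const_mul _)

theorem measurableSet_dyadicCube (k : ℕ) (z : Fin n → ℤ) : MeasurableSet (dyadicCube k z) :=
  measurable_dyadicIndex k (MeasurableSet.singleton z)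

theorem dyadicCube_eq_pi (k : ℕ) (z : Fin n → ℤ) :
    dyadicCube k z = Set.univ.pi fun i =>
      Set.Ico ((1 / 2 : ℝ) ^ k * z i) ((1 / 2 : ℝ) ^ k * z i + (1 / 2 : ℝ) ^ k) := by
  ext x
  simp only [dyadicCube, dyadicIndex, mem_ofPred_eq, funext_iff, Int.floor_eq_iff, Set.mem_pi,
    mem_univ, true_imp_iff, mem_Ico]
  refine forall_congr' fun i => ?_
  have h2 : (0 : ℝ) < 2 ^ k := by positivity
  rw [one_div, inv_pow]
  refine and_congr ?_ ?_
  · rw [inv_mul_le_iff₀ h2]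
  · rw [show ((2 : ℝ) ^ k)⁻¹ * z i + (2 ^ k)⁻¹ = (2 ^ k)⁻¹ * (z i + 1) by ring,
      lt_inv_mul_iff₀ h2]

theorem volume_dyadicCube (k : ℕ) (z : Fin n → ℤ) :
    volume (dyadicCube k z) = ENNReal.ofReal (((1 / 2 : ℝ) ^ k) ^ n) := by
  rw [dyadicCube_eq_pi, Real.volume_pi_Ico]
  simp only [add_sub_cancel_left, Finset.prod_const, Finset.card_univ, Fintype.card_fin]
  rw [← ENNReal.ofReal_pow (by positivity)]

theorem dyadicParent_dyadicIndex (k : ℕ) (x : Fin n → ℝ) :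
    dyadicParent (dyadicIndex (k + 1) x) = dyadicIndex k x := by
  funext i
  simp only [dyadicParent, dyadicIndex]
  symm
  rw [Int.floor_eq_iff]
  have h1 := Int.floor_le ((2 : ℝ) ^ (k + 1) * x i)
  have h2 := Int.lt_floor_add_one ((2 : ℝ) ^ (k + 1) * x i)
  generalize ⌊(2 : ℝ) ^ (k + 1) * x i⌋ = m at *
  have e1 : ((2 * (m / 2) : ℤ) : ℝ) ≤ m := by exact_mod_cast (by omega)
  have e2 : (m : ℝ) ≤ ((2 * (m / 2) + 1 : ℤ) : ℝ) := by exact_mod_cast (by omega)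
  push_cast at e1 e2
  rw [pow_succ] at h1 h2
  constructor <;> linarith

theorem dyadicIndex_eq_of_le {j k : ℕ} (hjk : j ≤ k) {x y : Fin n → ℝ}
    (hxy : dyadicIndex k x = dyadicIndex k y) : dyadicIndex j x = dyadicIndex j y := by
  induction k, hjk using Nat.le_induction with
  | base => exact hxy
  | succ k _ ih =>
    apply ih
    rw [← dyadicParent_dyadicIndex, hxy, dyadicParent_dyadicIndex]

theorem IsGauge.antitone_dyadicGauge {h : ℝ → ℝ} (hg : IsGauge h) :
    Antitone (dyadicGauge n h) := by
  intro j k hjk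
  refine ENNReal.ofReal_le_ofReal (hg.mono ?_ ?_ ?_)
  · simp only [mem_Ici]; positivity
  · simp only [mem_Ici]; positivity
  · exact pow_le_pow_left₀ (by positivity)
      (pow_le_pow_of_le_one (by norm_num) (by norm_num) hjk) n

theorem IsGauge.eventually_mul_volume_le {h : ℝ → ℝ} (hg : IsGauge h) (hn : 1 ≤ n) (L : NNReal) :
    ∀ᶠ k in atTop, ∀ z : Fin n → ℤ, L * volume (dyadicCube k z) ≤ dyadicGauge n h k := by
  have ht : Tendsto (fun k : ℕ => ((1 / 2 : ℝ) ^ k) ^ n) atTop (𝓝[>] 0) := by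
    refine tendsto_nhdsWithin_iff.2 ⟨?_, Eventually.of_forall fun k => ?_⟩
    · have := (tendsto_pow_atTop_nhds_zero_of_lt_one (r := (1 / 2 : ℝ))
        (by norm_num) (by norm_num)).pow n
      simpa [zero_pow (by omega : n ≠ 0)] using this
    · simp only [mem_Ioi]; positivity
  filter_upwards [(hg.r2.comp ht).eventually_ge_atTop (L : ℝ)] with k hk z
  have hpos : (0 : ℝ) < ((1 / 2 : ℝ) ^ k) ^ n := by positivity
  rw [Function.comp_apply, le_div_iff₀ hpos] at hk
  rw [volume_dyadicCube, dyadicGauge, ← ENNReal.ofReal_coe_nnreal,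
    ← ENNReal.ofReal_mul L.coe_nonneg]
  exact ENNReal.ofReal_le_ofReal hk

/-- Measurable functions below `R` satisfying the gauge bound on all dyadic cubes. -/
structure DyadicFeasible (h : ℝ → ℝ) (R f : (Fin n → ℝ) → ENNReal) : Prop where
  measurable : Measurable f
  le_roof : ∀ x, f x ≤ R x
  lintegral_le : ∀ k z, ∫⁻ x in dyadicCube k z, f x ≤ dyadicGauge n h k

/-- The largest mass that a dyadically feasible function can put on a dyadic cube. -/
noncomputable def dyadicMass (h : ℝ → ℝ) (R : (Fin n → ℝ) → ENNReal) (k : ℕ) (z : Fin n → ℤ) :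
    ENNReal :=
  ⨆ (f : (Fin n → ℝ) → ENNReal) (_ : DyadicFeasible h R f), ∫⁻ x in dyadicCube k z, f x

theorem DyadicFeasible.le_dyadicMass {h : ℝ → ℝ} {R f : (Fin n → ℝ) → ENNReal}
    (hf : DyadicFeasible h R f) (k : ℕ) (z : Fin n → ℤ) :
    ∫⁻ x in dyadicCube k z, f x ≤ dyadicMass h R k z :=
  le_iSup₂_of_le f hf le_rfl

theorem dyadicMass_le_dyadicGauge (h : ℝ → ℝ) (R : (Fin n → ℝ) → ENNReal) (k : ℕ)
    (z : Fin n → ℤ) : dyadicMass h R k z ≤ dyadicGauge n h k :=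
  iSup₂_le fun _ hf => hf.lintegral_le k z

theorem dyadicMass_ne_top (h : ℝ → ℝ) (R : (Fin n → ℝ) → ENNReal) (k : ℕ) (z : Fin n → ℤ) :
    dyadicMass h R k z ≠ ⊤ :=
  ((dyadicMass_le_dyadicGauge h R k z).trans_lt ENNReal.ofReal_lt_top).ne

/-- A function of total mass at most the gauge at scale `k` need only be tested on smaller cubes. -/
theorem DyadicFeasible.of_lintegral_le {h : ℝ → ℝ} (hg : IsGauge h)
    {R f : (Fin n → ℝ) → ENNReal} (hf : Measurable f) (hfR : ∀ x, f x ≤ R x) (k : ℕ)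
    (htot : ∫⁻ x, f x ≤ dyadicGauge n h k)
    (hsmall : ∀ j, k < j → ∀ z, ∫⁻ x in dyadicCube j z, f x ≤ dyadicGauge n h j) :
    DyadicFeasible h R f := by
  refine ⟨hf, hfR, fun j z => ?_⟩
  rcases le_or_gt j k with hjk | hjk
  · exact (setLIntegral_le_lintegral _ _).trans (htot.trans (hg.antitone_dyadicGauge hjk))
  · exact hsmall j hjk z

theorem DyadicFeasible.zero (h : ℝ → ℝ) (R : (Fin n → ℝ) → ENNReal) :
    DyadicFeasible h R 0 :=
  ⟨measurable_zero, fun _ => zero_le, fun _ _ => by simp⟩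

theorem IsGauge.eventually_lintegral_min_le_dyadicMass {h : ℝ → ℝ} (hg : IsGauge h) (hn : 1 ≤ n)
    {R : (Fin n → ℝ) → ENNReal} (hR : Measurable R) (L : NNReal) :
    ∀ᶠ k in atTop, ∀ z : Fin n → ℤ,
      ∫⁻ x in dyadicCube k z, min (R x) L ≤ dyadicMass h R k z := by
  obtain ⟨K, hK⟩ := eventually_atTop.1 (hg.eventually_mul_volume_le hn L)
  filter_upwards [eventually_ge_atTop K] with k hk z
  have hm : Measurable fun x => min (R x) (L : ENNReal) := hR.min measurable_const
  have hbd : ∀ j, K ≤ j → ∀ y : Fin n → ℤ,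
      ∫⁻ x in dyadicCube j y, min (R x) L ≤ dyadicGauge n h j := fun j hj y =>
    (lintegral_mono fun x => min_le_right _ _).trans (by
      rw [setLIntegral_const]; exact hK j hj y)
  have hfeas : DyadicFeasible h R ((dyadicCube k z).indicator fun x => min (R x) L) := by
    refine .of_lintegral_le hg (hm.indicator (measurableSet_dyadicCube k z)) (fun x => ?_) k ?_
      fun j hj y => ?_
    · exact indicator_le_self' (fun _ _ => zero_le) x |>.trans (min_le_left _ _)
    · rw [lintegral_indicator (measurableSet_dyadicCube k z)]
      exact hbd k hk z
    · exact (lintegral_mono (indicator_le_self' fun _ _ => zero_le)).trans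
        (hbd j (hk.trans hj.le) y)
  have := hfeas.le_dyadicMass k z
  rwa [setLIntegral_indicator (measurableSet_dyadicCube k z), inter_self] at this

/-- Feasible functions on finitely many children of a cube glue together, after scaling. -/
theorem DyadicFeasible.min_sum_le_dyadicMass {h : ℝ → ℝ} (hg : IsGauge h)
    {R : (Fin n → ℝ) → ENNReal} (k : ℕ) (z : Fin n → ℤ)
    (s : Finset {w : Fin n → ℤ // dyadicParent w = z})
    (F : {w : Fin n → ℤ // dyadicParent w = z} → (Fin n → ℝ) → ENNReal)
    (hF : ∀ w, DyadicFeasible h R (F w)) :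
    min (dyadicGauge n h k) (∑ w ∈ s, ∫⁻ x in dyadicCube (k + 1) w.1, F w x)
      ≤ dyadicMass h R k z := by
  classical
  set g : (Fin n → ℝ) → ENNReal :=
    fun x => ∑ w ∈ s, (dyadicCube (k + 1) w.1).indicator (F w) x with hgdef
  have hgm : Measurable g := Finset.measurable_sum _ fun w _ =>
    (hF w).measurable.indicator (measurableSet_dyadicCube _ _)
  have hgint : ∫⁻ x, g x = ∑ w ∈ s, ∫⁻ x in dyadicCube (k + 1) w.1, F w x := by
    rw [hgdef, lintegral_finsetSum _ fun w _ =>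
      (hF w).measurable.indicator (measurableSet_dyadicCube _ _)]
    exact Finset.sum_congr rfl fun w _ => lintegral_indicator (measurableSet_dyadicCube _ _) _
  have hgeq : ∀ x, g x = 0 ∨ ∃ w ∈ s, dyadicIndex (k + 1) x = w.1 ∧ g x = F w x := by
    intro x
    by_cases hx : ∃ w ∈ s, dyadicIndex (k + 1) x = w.1
    · obtain ⟨w, hw, hxw⟩ := hx
      refine Or.inr ⟨w, hw, hxw, ?_⟩
      rw [hgdef]
      dsimp only
      rw [Finset.sum_eq_single_of_mem w hw,
        indicator_of_mem (show x ∈ dyadicCube (k + 1) w.1 from hxw)]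
      intro v _ hv
      exact indicator_of_notMem (fun hxv => hv (Subtype.ext (hxv.symm.trans hxw))) _
    · refine Or.inl (Finset.sum_eq_zero fun w hw => indicator_of_notMem ?_ _)
      exact fun hxw => hx ⟨w, hw, hxw⟩
  have hgR : ∀ x, g x ≤ R x := by
    intro x
    rcases hgeq x with h0 | ⟨w, _, _, h0⟩
    · simp [h0]
    · exact h0 ▸ (hF w).le_roof x
  have hgtop : ∫⁻ x, g x ≠ ⊤ := by
    rw [hgint]
    exact ENNReal.sum_ne_top.2 fun w _ =>
      (((hF w).lintegral_le _ _).trans_lt ENNReal.ofReal_lt_top).ne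
  have hgsmall : ∀ j, k < j → ∀ y, ∫⁻ x in dyadicCube j y, g x ≤ dyadicGauge n h j := by
    intro j hj y
    by_cases hy : ∃ x₀ ∈ dyadicCube j y, ∃ w ∈ s, dyadicIndex (k + 1) x₀ = w.1
    · obtain ⟨x₀, hx₀, w, hw, hxw⟩ := hy
      refine le_trans (setLIntegral_mono (hF w).measurable fun x hx => ?_) ((hF w).lintegral_le j y)
      have hxx : dyadicIndex (k + 1) x = w.1 :=
        (dyadicIndex_eq_of_le hj (hx.trans hx₀.symm)).trans hxw
      rcases hgeq x with h0 | ⟨v, _, hxv, h0⟩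
      · simp [h0]
      · rw [h0, Subtype.ext (hxv.symm.trans hxx)]
    · rw [setLIntegral_congr_fun (g := fun _ => 0) (measurableSet_dyadicCube j y)]
      · simp
      · intro x hx
        rcases hgeq x with h0 | ⟨v, hv, hxv, _⟩
        · exact h0
        · exact absurd ⟨x, hx, v, hv, hxv⟩ hy
  have hsupp : ∫⁻ x in dyadicCube k z, g x = ∫⁻ x, g x := by
    refine setLIntegral_eq_of_support_subset ?_
    intro x hx
    rcases hgeq x with h0 | ⟨w, _, hxw, _⟩
    · exact absurd h0 hx
    · change dyadicIndex k x = z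
      rw [← dyadicParent_dyadicIndex, hxw, w.2]
  rw [← hgint]
  rcases le_or_gt (∫⁻ x, g x) (dyadicGauge n h k) with hle | hlt
  · have := (DyadicFeasible.of_lintegral_le hg hgm hgR k hle hgsmall).le_dyadicMass k z
    rw [hsupp] at this
    exact (min_le_right _ _).trans this
  · set α := dyadicGauge n h k / ∫⁻ x, g x with hα
    have hα1 : α ≤ 1 := ENNReal.div_le_of_le_mul (by simpa using hlt.le)
    have hmul : α * ∫⁻ x, g x = dyadicGauge n h k :=
      ENNReal.div_mul_cancel (zero_le.trans_lt hlt).ne' hgtop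
    have hαg : ∀ x, α * g x ≤ g x := fun x => mul_le_of_le_one_left zero_le hα1
    have hfeas : DyadicFeasible h R fun x => α * g x := by
      refine .of_lintegral_le hg (hgm.const_mul α) (fun x => (hαg x).trans (hgR x)) k ?_
        fun j hj y => (lintegral_mono hαg).trans (hgsmall j hj y)
      rw [lintegral_const_mul _ hgm, hmul]
    have := hfeas.le_dyadicMass k z
    rw [lintegral_const_mul _ hgm, hsupp, hmul] at this
    exact (min_le_left _ _).trans this

theorem IsGauge.tsum_dyadicMass_le {h : ℝ → ℝ} (hg : IsGauge h)
    {R : (Fin n → ℝ) → ENNReal} {k : ℕ} {z : Fin n → ℤ}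
    (hz : dyadicMass h R k z < dyadicGauge n h k) :
    ∑' w : {w : Fin n → ℤ // dyadicParent w = z}, dyadicMass h R (k + 1) w.1
      ≤ dyadicMass h R k z := by
  rw [ENNReal.tsum_eq_iSup_sum]
  refine iSup_le fun s => ENNReal.le_of_forall_pos_le_add fun ε hε _ => ?_
  obtain ⟨δ, hδ, hδε⟩ := ENNReal.exists_pos_sum_of_countable
    (ENNReal.coe_pos.2 hε).ne' {w : Fin n → ℤ // dyadicParent w = z}
  have hex : ∀ w : {w : Fin n → ℤ // dyadicParent w = z}, ∃ f, DyadicFeasible h R f ∧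
      dyadicMass h R (k + 1) w.1 ≤ (∫⁻ x in dyadicCube (k + 1) w.1, f x) + δ w := by
    intro w
    rcases eq_or_ne (dyadicMass h R (k + 1) w.1) 0 with h0 | h0
    · exact ⟨0, .zero h R, by simp [h0]⟩
    · have hlt := ENNReal.sub_lt_self (dyadicMass_ne_top h R (k + 1) w.1) h0
        (ENNReal.coe_pos.2 (hδ w)).ne'
      obtain ⟨f, hf⟩ := lt_iSup_iff.1 hlt
      obtain ⟨hf, hlt⟩ := lt_iSup_iff.1 hf
      exact ⟨f, hf, tsub_le_iff_right.1 hlt.le⟩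
  choose F hF hFm using hex
  have hmin := DyadicFeasible.min_sum_le_dyadicMass hg k z s F hF
  have hsum : ∑ w ∈ s, ∫⁻ x in dyadicCube (k + 1) w.1, F w x ≤ dyadicMass h R k z := by
    rcases min_le_iff.1 hmin with hm | hm
    · exact absurd hm hz.not_ge
    · exact hm
  calc ∑ w ∈ s, dyadicMass h R (k + 1) w.1
      ≤ ∑ w ∈ s, ((∫⁻ x in dyadicCube (k + 1) w.1, F w x) + δ w) :=
        Finset.sum_le_sum fun w _ => hFm w
    _ = (∑ w ∈ s, ∫⁻ x in dyadicCube (k + 1) w.1, F w x) + ∑ w ∈ s, (δ w : ENNReal) :=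
        Finset.sum_add_distrib
    _ ≤ dyadicMass h R k z + ε := add_le_add hsum ((ENNReal.sum_le_tsum s).trans hδε.le)

/-- No strict dyadic ancestor of the cube is saturated. -/
def DyadicUncovered (h : ℝ → ℝ) (R : (Fin n → ℝ) → ENNReal) : ℕ → (Fin n → ℤ) → Prop
  | 0, _ => True
  | k + 1, z => DyadicUncovered h R k (dyadicParent z) ∧
      dyadicMass h R k (dyadicParent z) < dyadicGauge n h k

/-- The cube is a maximal saturated dyadic cube. -/
def DyadicSelected (h : ℝ → ℝ) (R : (Fin n → ℝ) → ENNReal) (k : ℕ) (z : Fin n → ℤ) : Prop :=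
  DyadicUncovered h R k z ∧ dyadicGauge n h k ≤ dyadicMass h R k z

open Classical in
theorem IsGauge.sum_selected_add_uncovered_le {h : ℝ → ℝ} (hg : IsGauge h)
    (R : (Fin n → ℝ) → ENNReal) (K : ℕ) :
    (∑ k ∈ Finset.range K, ∑' z, if DyadicSelected h R k z then dyadicGauge n h k else 0) +
      ∑' z, (if DyadicUncovered h R K z then dyadicMass h R K z else 0)
      ≤ ∑' z, dyadicMass h R 0 z := by
  induction K with
  | zero => simp [DyadicUncovered]
  | succ K ih =>
    refine le_trans ?_ ih
    rw [Finset.sum_range_succ, add_assoc]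
    gcongr
    rw [← (Equiv.sigmaFiberEquiv (dyadicParent (n := n))).tsum_eq
        fun w => if DyadicUncovered h R (K + 1) w then dyadicMass h R (K + 1) w else 0,
      ENNReal.tsum_sigma', ← ENNReal.tsum_add]
    refine ENNReal.tsum_le_tsum fun z => ?_
    have hchild : ∀ w : {w : Fin n → ℤ // dyadicParent w = z},
        DyadicUncovered h R (K + 1) w.1 ↔
          DyadicUncovered h R K z ∧ dyadicMass h R K z < dyadicGauge n h K := by
      rintro ⟨w, rfl⟩
      rfl
    simp only [Equiv.sigmaFiberEquiv, Equiv.coe_fn_mk, hchild, DyadicSelected]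
    by_cases hu : DyadicUncovered h R K z
    · rcases lt_or_ge (dyadicMass h R K z) (dyadicGauge n h K) with hlt | hge
      · simpa [hu, hlt, hlt.not_ge] using hg.tsum_dyadicMass_le hlt
      · simp [hu, hge, hge.not_gt]
    · simp [hu]

/-- A point outside all selected cubes lies in uncovered cubes of every scale. -/
theorem dyadicUncovered_of_forall_not_selected {h : ℝ → ℝ} {R : (Fin n → ℝ) → ENNReal}
    {x : Fin n → ℝ} (hx : ∀ k, ¬ DyadicSelected h R k (dyadicIndex k x)) (K : ℕ) :
    DyadicUncovered h R K (dyadicIndex K x) := by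
  induction K with
  | zero => trivial
  | succ K ih =>
    rw [DyadicUncovered, dyadicParent_dyadicIndex]
    exact ⟨ih, not_le.1 fun hge => hx K ⟨ih, hge⟩⟩

open Classical in
theorem IsGauge.tsum_selected_add_lintegral_le {h : ℝ → ℝ} (hg : IsGauge h) (hn : 1 ≤ n)
    {R : (Fin n → ℝ) → ENNReal} (hR : Measurable R) {D : Set (Fin n → ℝ)}
    (hD : ∀ x ∈ D, ∀ k, ¬ DyadicSelected h R k (dyadicIndex k x)) :
    (∑' k, ∑' z, if DyadicSelected h R k z then dyadicGauge n h k else 0) + ∫⁻ x in D, R x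
      ≤ ∑' z, dyadicMass h R 0 z := by
  have htrunc : ∀ L : ℕ,
      (∑' k, ∑' z, if DyadicSelected h R k z then dyadicGauge n h k else 0) +
        ∫⁻ x in D, min (R x) L ≤ ∑' z, dyadicMass h R 0 z := by
    intro L
    have hev := hg.eventually_lintegral_min_le_dyadicMass hn hR L
    refine le_of_tendsto ((ENNReal.tendsto_nat_tsum _).add tendsto_const_nhds)
      (hev.mono fun K hK => le_trans ?_ (hg.sum_selected_add_uncovered_le R K))
    gcongr
    calc ∫⁻ x in D, min (R x) L
        ≤ ∫⁻ x in ⋃ z : {z // DyadicUncovered h R K z}, dyadicCube K z.1, min (R x) L :=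
          lintegral_mono_set fun x hx => mem_iUnion.2
            ⟨⟨dyadicIndex K x, dyadicUncovered_of_forall_not_selected (hD x hx) K⟩, rfl⟩
      _ ≤ ∑' z : {z // DyadicUncovered h R K z}, ∫⁻ x in dyadicCube K z.1, min (R x) L :=
          lintegral_iUnion_le _ _
      _ ≤ ∑' z : {z // DyadicUncovered h R K z}, dyadicMass h R K z.1 :=
          ENNReal.tsum_le_tsum fun z => hK z.1
      _ = ∑' z, (if DyadicUncovered h R K z then dyadicMass h R K z else 0) :=
          tsum_subtype {z | DyadicUncovered h R K z} (dyadicMass h R K)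
  have hsup : ∫⁻ x in D, R x = ⨆ L : ℕ, ∫⁻ x in D, min (R x) L := by
    rw [← lintegral_iSup]
    · refine lintegral_congr fun x => ?_
      rw [← inf_iSup_eq, ENNReal.iSup_natCast, inf_top_eq]
    · exact fun L => hR.min measurable_const
    · exact fun L L' hL x => min_le_min_left _ (by exact_mod_cast hL)
  rw [hsup, ENNReal.add_iSup]
  exact iSup_le htrunc

theorem volume_cube (a : Fin n → ℝ) {s : ℝ} (hs : 0 < s) :
    (volume (Set.univ.pi fun i => Set.Icc (a i) (a i + s))).toReal = s ^ n := by
  rw [Set.pi_univ_Icc, Real.volume_Icc_pi]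
  simp [← ENNReal.ofReal_pow hs.le, pow_nonneg hs.le]

theorem IsCube.measurableSet {c : Set (Fin n → ℝ)} (hc : IsCube c) : MeasurableSet c := by
  obtain ⟨a, s, -, rfl⟩ := hc
  exact MeasurableSet.univ_pi fun i => measurableSet_Icc

theorem iSup_memF_le_Mh (h : ℝ → ℝ) (R : (Fin n → ℝ) → ENNReal) :
    (⨆ (f : (Fin n → ℝ) → NNReal) (_ : MemF h R f), ∫⁻ x, (f x : ENNReal)) ≤ Mh h R := by
  refine iSup₂_le fun f hf => le_iInf₂ fun c hc => ?_
  have hcm : MeasurableSet (⋃ k, c k) := MeasurableSet.iUnion fun k =>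
    (hc k).elim IsCube.measurableSet fun h0 => h0 ▸ MeasurableSet.empty
  rw [← lintegral_add_compl _ hcm]
  refine add_le_add ((lintegral_iUnion_le _ _).trans (ENNReal.tsum_le_tsum fun k => ?_))
    (lintegral_mono_ae (ae_restrict_of_ae hf.le_roof))
  rcases hc k with hk | hk
  · exact hf.cube_bound _ hk
  · simp [hk]

/-- A cube of side at most twice the dyadic side meets at most `3 ^ n` dyadic cubes. -/
theorem DyadicFeasible.lintegral_cube_le {h : ℝ → ℝ} {R f : (Fin n → ℝ) → ENNReal}
    (hf : DyadicFeasible h R f) (k : ℕ) (a : Fin n → ℝ) {s : ℝ} (hs : s ≤ 2 * (1 / 2 : ℝ) ^ k) :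
    ∫⁻ x in Set.univ.pi fun i => Set.Icc (a i) (a i + s), f x
      ≤ (3 : ENNReal) ^ n * dyadicGauge n h k := by
  have h2 : (0 : ℝ) < 2 ^ k := by positivity
  set T : Finset (Fin n → ℤ) :=
    Fintype.piFinset fun i => Finset.Icc (dyadicIndex k a i) (dyadicIndex k a i + 2) with hT
  have hcard : T.card = 3 ^ n := by
    have h3 : ∀ m : ℤ, m + 2 + 1 - m = 3 := fun m => by ring
    simp [hT, Fintype.card_piFinset, h3]
  have hsub : (Set.univ.pi fun i => Set.Icc (a i) (a i + s)) ⊆ ⋃ z ∈ T, dyadicCube k z := by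
    intro x hx
    simp only [mem_iUnion]
    refine ⟨dyadicIndex k x, Fintype.mem_piFinset.2 fun i => Finset.mem_Icc.2 ⟨?_, ?_⟩, rfl⟩
    · exact Int.floor_le_floor (mul_le_mul_of_nonneg_left (hx i trivial).1 h2.le)
    · rw [dyadicIndex, dyadicIndex, ← Int.floor_add_ofNat]
      refine Int.floor_le_floor ?_
      calc (2 : ℝ) ^ k * x i ≤ 2 ^ k * (a i + 2 * (1 / 2 : ℝ) ^ k) :=
            mul_le_mul_of_nonneg_left ((hx i trivial).2.trans (by linarith)) h2.le
        _ = 2 ^ k * a i + 2 := by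
            rw [one_div, inv_pow]
            field_simp
  calc ∫⁻ x in Set.univ.pi fun i => Set.Icc (a i) (a i + s), f x
      ≤ ∫⁻ x in ⋃ z ∈ T, dyadicCube k z, f x := lintegral_mono_set hsub
    _ ≤ ∑ z ∈ T, ∫⁻ x in dyadicCube k z, f x := by
        rw [← Finset.tsum_subtype]
        refine (lintegral_mono_set (iUnion₂_subset fun z hz => ?_)).trans
          (lintegral_iUnion_le (fun z : {z // z ∈ T} => dyadicCube k z.1) f)
        exact subset_iUnion (fun z : {z // z ∈ T} => dyadicCube k z.1) ⟨z, hz⟩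
    _ ≤ ∑ _z ∈ T, dyadicGauge n h k := Finset.sum_le_sum fun z _ => hf.lintegral_le k z
    _ = 3 ^ n * dyadicGauge n h k := by
        rw [Finset.sum_const, hcard, nsmul_eq_mul]
        push_cast
        rfl

/-- A dyadically feasible function on the unit cube becomes feasible after division by `3 ^ n`. -/
theorem DyadicFeasible.lintegral_le_iSup_memF {h : ℝ → ℝ} (hg : IsGauge h)
    {R f : (Fin n → ℝ) → ENNReal}
    (hf : DyadicFeasible h ((dyadicCube 0 0).indicator R) f) :
    ∫⁻ x in dyadicCube 0 0, f x ≤ (3 : ENNReal) ^ n *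
      (⨆ (g : (Fin n → ℝ) → NNReal) (_ : MemF h R g), ∫⁻ x, (g x : ENNReal)) := by
  have h30 : (3 : ENNReal) ^ n ≠ 0 := by positivity
  have h3t : (3 : ENNReal) ^ n ≠ ⊤ := ENNReal.pow_ne_top (by simp)
  have hsupp : ∫⁻ x in dyadicCube 0 0, f x = ∫⁻ x, f x := by
    refine setLIntegral_eq_of_support_subset fun x hx => ?_
    by_contra hx0
    have := hf.le_roof x
    rw [indicator_of_notMem hx0] at this
    exact hx (le_antisymm this zero_le)
  have htot : ∫⁻ x, f x ≤ dyadicGauge n h 0 := hsupp ▸ hf.lintegral_le 0 0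
  have hfin : ∀ᵐ x, f x < ⊤ :=
    ae_lt_top hf.measurable (htot.trans_lt ENNReal.ofReal_lt_top).ne
  set g : (Fin n → ℝ) → NNReal := fun x => (((3 : ENNReal) ^ n)⁻¹ * f x).toNNReal with hgdef
  have hgf : ∀ᵐ x, (g x : ENNReal) = ((3 : ENNReal) ^ n)⁻¹ * f x := by
    filter_upwards [hfin] with x hx
    exact ENNReal.coe_toNNReal (ENNReal.mul_ne_top (ENNReal.inv_ne_top.2 h30) hx.ne)
  have hinv : ((3 : ENNReal) ^ n)⁻¹ ≤ 1 :=
    ENNReal.inv_le_one.2 (one_le_pow₀ (by norm_num))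
  have hint : ∀ c : Set (Fin n → ℝ), ∫⁻ x in c, (g x : ENNReal) =
      ((3 : ENNReal) ^ n)⁻¹ * ∫⁻ x in c, f x := fun c => by
    rw [lintegral_congr_ae (ae_restrict_of_ae hgf), lintegral_const_mul _ hf.measurable]
  have hmem : MemF h R g := by
    refine ⟨(hf.measurable.const_mul _).ennreal_toNNReal, ?_, ?_⟩
    · rintro c ⟨a, s, hs, rfl⟩
      rw [hint, volume_cube a hs]
      have hmono : ∀ k : ℕ, (1 / 2 : ℝ) ^ k ≤ s → dyadicGauge n h k ≤ ENNReal.ofReal (h (s ^ n)) :=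
        fun k hk => ENNReal.ofReal_le_ofReal (hg.mono (mem_Ici.2 (by positivity))
          (mem_Ici.2 (by positivity)) (pow_le_pow_left₀ (by positivity) hk n))
      rcases le_or_gt s 1 with hs1 | hs1
      · obtain ⟨k, hk, hk'⟩ := exists_nat_pow_near_of_lt_one hs hs1
          (by norm_num : (0 : ℝ) < 1 / 2) (by norm_num)
        have hcube := hf.lintegral_cube_le (k + 1) a (s := s) (by rw [pow_succ]; linarith)
        rw [ENNReal.inv_mul_le_iff h30 h3t]
        exact hcube.trans (mul_le_mul_right (hmono _ hk.le) _)
      · exact (mul_le_of_le_one_left zero_le hinv).trans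
          ((setLIntegral_le_lintegral _ _).trans (htot.trans (hmono 0 (by simpa using hs1.le))))
    · filter_upwards [hgf] with x hx
      rw [hx]
      exact (mul_le_of_le_one_left zero_le hinv).trans
        ((hf.le_roof x).trans (indicator_le_self' (fun _ _ => zero_le) x))
  rw [← ENNReal.inv_mul_le_iff h30 h3t, hsupp]
  refine le_iSup₂_of_le g hmem ?_
  have := hint univ
  rw [setLIntegral_univ, setLIntegral_univ] at this
  exact this.ge

theorem tsum_dyadicMass_indicator_le (h : ℝ → ℝ) (R : (Fin n → ℝ) → ENNReal) :
    ∑' z, dyadicMass h ((dyadicCube 0 0).indicator R) 0 z ≤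
      dyadicMass h ((dyadicCube 0 0).indicator R) 0 0 := by
  rw [tsum_eq_single 0]
  intro z hz
  refine le_antisymm (iSup₂_le fun f hf => ?_) zero_le
  rw [setLIntegral_congr_fun (g := fun _ => 0) (measurableSet_dyadicCube 0 z)]
  · simp
  · intro x hx
    have := hf.le_roof x
    rw [indicator_of_notMem fun hx0 : x ∈ dyadicCube 0 0 => hz (hx.symm.trans hx0)] at this
    exact le_antisymm this zero_le

theorem dyadicCube_zero_ae_eq_unitCube :
    (dyadicCube 0 0 : Set (Fin n → ℝ)) =ᵐ[volume] unitCube n := by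
  have := Measure.univ_pi_Ico_ae_eq_Icc (μ := fun _ : Fin n => (volume : Measure ℝ))
    (f := fun _ => 0) (g := fun _ => 1)
  rw [← Set.pi_univ_Icc] at this
  rw [dyadicCube_eq_pi]
  simpa [unitCube, volume_pi] using this

open Classical in
/-- The selected dyadic cubes, closed up, are competitors in the definition of `Mh`. -/
theorem Mh_le_tsum_add_lintegral {h : ℝ → ℝ} (hg : IsGauge h) (R : (Fin n → ℝ) → ENNReal)
    (P : ℕ → (Fin n → ℤ) → Prop) :
    ∃ D : Set (Fin n → ℝ), (∀ x ∈ D, ∀ k, ¬ P k (dyadicIndex k x)) ∧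
      Mh h R ≤ (∑' k, ∑' z, if P k z then dyadicGauge n h k else 0) + ∫⁻ x in D, R x := by
  obtain ⟨e⟩ : Nonempty (ℕ ≃ ℕ × (Fin n → ℤ)) := nonempty_equiv_of_countable
  set C : ℕ × (Fin n → ℤ) → Set (Fin n → ℝ) := fun p => if P p.1 p.2 then
    Set.univ.pi fun i => Set.Icc ((1 / 2 : ℝ) ^ p.1 * p.2 i)
      ((1 / 2 : ℝ) ^ p.1 * p.2 i + (1 / 2 : ℝ) ^ p.1) else ∅ with hC
  refine ⟨(⋃ k, C (e k))ᶜ, fun x hx k hP => hx ?_, ?_⟩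
  · refine mem_iUnion.2 ⟨e.symm (k, dyadicIndex k x), ?_⟩
    rw [e.apply_symm_apply, hC]
    dsimp only
    rw [if_pos hP]
    have hmem : x ∈ dyadicCube k (dyadicIndex k x) := rfl
    rw [dyadicCube_eq_pi] at hmem
    exact fun i hi => Ico_subset_Icc_self (hmem i hi)
  · refine (iInf₂_le (fun k => C (e k)) fun k => ?_).trans (add_le_add_left (le_of_eq ?_) _)
    · by_cases hP : P (e k).1 (e k).2
      · exact Or.inl ⟨fun i => (1 / 2 : ℝ) ^ (e k).1 * (e k).2 i, (1 / 2 : ℝ) ^ (e k).1,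
          by positivity, by simp only [hC, if_pos hP]⟩
      · exact Or.inr (by simp only [hC, if_neg hP])
    · rw [e.tsum_eq fun p => ENNReal.ofReal (h (volume (C p)).toReal), ENNReal.tsum_prod']
      refine tsum_congr fun k => tsum_congr fun z => ?_
      by_cases hP : P k z
      · simp only [hC, if_pos hP, dyadicGauge]
        rw [volume_cube (fun i => (1 / 2 : ℝ) ^ k * z i) (by positivity)]
      · simp [hC, hP, hg.zero]

end DyadicCubes

/-- main duality theorem. `M_h(R) ≤ 3^n · sup_{f ∈ F_n(R,h)} ‖f‖₁`;
together with the trivial inequality `sup ≤ M_h(R)` this gives the two-sided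
comparison with proportionality constant `3^n`. -/
theorem duality_theorem {n : ℕ} (hn : 1 ≤ n) (h : ℝ → ℝ) (hg : IsGauge h)
    (R : (Fin n → ℝ) → ENNReal) (hRmeas : Measurable R)
    (hRsupp : ∀ x, x ∉ unitCube n → R x = 0) :
    Mh h R ≤ (3 : ENNReal) ^ n *
      (⨆ (f : (Fin n → ℝ) → NNReal) (_ : MemF h R f), ∫⁻ x, (f x : ENNReal)) ∧
    (⨆ (f : (Fin n → ℝ) → NNReal) (_ : MemF h R f), ∫⁻ x, (f x : ENNReal)) ≤ Mh h R := by
  refine ⟨?_, iSup_memF_le_Mh h R⟩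
  set R' := (dyadicCube 0 0).indicator R with hR'
  have hR'm : Measurable R' := hRmeas.indicator (measurableSet_dyadicCube 0 0)
  have hae : R =ᵐ[volume] R' := by
    have hind : (unitCube n).indicator R = R :=
      indicator_eq_self.2 fun x hx => by_contra fun hxu => hx (hRsupp x hxu)
    have := indicator_ae_eq_of_ae_eq_set (f := R) (dyadicCube_zero_ae_eq_unitCube (n := n))
    rw [hind] at this
    exact this.symm
  obtain ⟨D, hD, hM⟩ := Mh_le_tsum_add_lintegral hg R (DyadicSelected h R')
  rw [lintegral_congr_ae (ae_restrict_of_ae hae)] at hM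
  calc Mh h R ≤ _ := hM
    _ ≤ _ := hg.tsum_selected_add_lintegral_le hn hR'm hD
    _ ≤ _ := tsum_dyadicMass_indicator_le h R
    _ ≤ _ := iSup₂_le fun f hf => hf.lintegral_le_iSup_memF hg
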